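/- Cut-to-full Kullback–Leibler bound under a compatible working prior: let Ω₁ be a standard Borel space and Ω₂ a countable discrete measurable space, let p_f be a probability measure on Ω₁ × Ω₂ with disintegration kernel κ of p_f given the first coordinate. Fix b₀ ∈ Ω₂ with w = p_f(Ω₁ × {b₀}) > 0, let p̄ be the first-coordinate marginal of the conditional measure p_f[· | snd = b₀], and let p_c = p̄ ⊗ₘ κ. Then KL(p_c ‖ p_f) ≤ −log(w). -/

import Mathlib

open MeasureTheory ProbabilityTheory ENNReal

open Classical in
/-- Kullback–Leibler divergence between two measures, with value `⊤` when `q` is not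
absolutely continuous with respect to `p` (or the log-likelihood ratio is not integrable). -/
noncomputable def KL {Ω : Type*} [MeasurableSpace Ω] (q p : Measure Ω) : ℝ≥0∞ :=
  if q ≪ p ∧ Integrable (llr q p) q then ENNReal.ofReal (∫ x, llr q p x ∂q) else ⊤

/-- For probability measures, `KL` agrees with Mathlib's Kullback–Leibler divergence. -/
lemma KL_eq_klDiv {Ω : Type*} [MeasurableSpace Ω] (q p : Measure Ω)
    [IsProbabilityMeasure q] [IsProbabilityMeasure p] :
    KL q p = InformationTheory.klDiv q p := by
  simp [KL, InformationTheory.klDiv]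

/-- The log-likelihood ratio of `p[|A]` with respect to `p` is almost surely `-log (p A)`. -/
lemma llr_cond_ae_eq {Ω : Type*} [MeasurableSpace Ω] (p : Measure Ω) [IsProbabilityMeasure p]
    {A : Set Ω} (hA : MeasurableSet A) (hpA : p A ≠ 0) :
    llr (p[|A]) p =ᵐ[p[|A]] fun _ ↦ -Real.log (p A).toReal := by
  have h_rnDeriv : (p[|A]).rnDeriv p =ᵐ[p] fun x ↦ (p A)⁻¹ * A.indicator 1 x := by
    filter_upwards [Measure.rnDeriv_smul_left_of_ne_top (p.restrict A) p
      (ENNReal.inv_ne_top.2 hpA), Measure.rnDeriv_restrict_self p hA] with x h₁ h₂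
    rw [ProbabilityTheory.cond, h₁, Pi.smul_apply, h₂, smul_eq_mul]
  filter_upwards [cond_absolutelyContinuous.ae_le h_rnDeriv, ae_cond_mem hA] with x hx hxA
  simp [llr, hx, hxA]

/-- Conditioning on an event `A` moves a probability measure by `-log (p A)`. -/
lemma KL_cond_self {Ω : Type*} [MeasurableSpace Ω] (p : Measure Ω) [IsProbabilityMeasure p]
    {A : Set Ω} (hA : MeasurableSet A) (hpA : p A ≠ 0) :
    KL (p[|A]) p = ENNReal.ofReal (-Real.log (p A).toReal) := by
  have := cond_isProbabilityMeasure hpA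
  have h := llr_cond_ae_eq p hA hpA
  rw [KL, if_pos ⟨cond_absolutelyContinuous, (integrable_const _).congr h.symm⟩,
    integral_congr_ae h]
  simp

/-- Cut-to-full KL bound under a compatible working prior: if the working marginal `pbar`
is the first marginal of the conditional `p_f[· | snd = b₀]` and `κ` is a disintegration
kernel of the full posterior `p_f`, then the KL divergence between the cut posterior
`pbar ⊗ₘ κ` and `p_f` is at most `-log p_f(snd = b₀)`. -/
theorem KL_cut_full_le_of_compatible_working_prior
    {Ω₁ Ω₂ : Type*} [MeasurableSpace Ω₁] [StandardBorelSpace Ω₁]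
    [MeasurableSpace Ω₂] [Countable Ω₂] [MeasurableSingletonClass Ω₂]
    (p_f : Measure (Ω₁ × Ω₂)) [IsProbabilityMeasure p_f]
    (κ : Kernel Ω₁ Ω₂) [IsMarkovKernel κ]
    (hκ : p_f = (p_f.map Prod.fst) ⊗ₘ κ)
    (b₀ : Ω₂) (hw : 0 < p_f (Prod.snd ⁻¹' {b₀})) :
    KL (((p_f[|Prod.snd ⁻¹' {b₀}]).map Prod.fst) ⊗ₘ κ) p_f
      ≤ ENNReal.ofReal (- Real.log ((p_f (Prod.snd ⁻¹' {b₀})).toReal)) := by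
  have := cond_isProbabilityMeasure hw.ne'
  have := Measure.isProbabilityMeasure_map (μ := p_f) measurable_fst.aemeasurable
  have := Measure.isProbabilityMeasure_map (μ := p_f[|Prod.snd ⁻¹' {b₀}])
    measurable_fst.aemeasurable
  have h_compProd := InformationTheory.klDiv_compProd_left
    ((p_f[|Prod.snd ⁻¹' {b₀}]).map Prod.fst) (p_f.map Prod.fst) κ
  rw [← hκ] at h_compProd
  rw [KL_eq_klDiv, h_compProd,
    ← KL_cond_self p_f (measurable_snd (measurableSet_singleton b₀)) hw.ne', KL_eq_klDiv]
  exact InformationTheory.klDiv_map_le _ _ measurable_fst
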